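/- Suppose Γ is a nonempty finite set of functions α : S → ℝ such that V_n(b) = max_{α ∈ Γ} Σ_s α(s) b(s) for all beliefs b. Then there exists a nonempty finite set Γ' of functions α : S → ℝ such that V_{n+1}(b) = max_{α ∈ Γ'} Σ_s α(s) b(s) for all beliefs b, and |Γ'| ≤ |U| · |Γ|^(|V|·|O|). -/

import Mathlib

open Finset

noncomputable section

variable {S U V O : Type*}

/-- `b : S → ℝ` is a belief (probability distribution over states). -/
def IsBelief [Fintype S] (b : S → ℝ) : Prop :=
  (∀ s, 0 ≤ b s) ∧ ∑ s, b s = 1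

/-- `P : S → V → ℝ` is a (mixed) strategy of the other agent. -/
def IsStrategy [Fintype V] (P : S → V → ℝ) : Prop :=
  (∀ s v, 0 ≤ P s v) ∧ ∀ s, ∑ v, P s v = 1

/-- Expected immediate payoff `R_P(b,u) = Σ_{s,v} b(s) P(s,v) R(s,u,v)`. -/
def expR [Fintype S] [Fintype V] (R : S → U → V → ℝ) (P : S → V → ℝ)
    (b : S → ℝ) (u : U) : ℝ :=
  ∑ s, ∑ v, b s * P s v * R s u v

/-- Belief-state observation model
`Pr_P(v,o|b,u) = Σ_{s'} Z(s',u,o) Σ_s T(s,u,v,s') P(s,v) b(s)`. -/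
def obsPr [Fintype S] (T : S → U → V → S → ℝ) (Z : S → U → O → ℝ)
    (P : S → V → ℝ) (b : S → ℝ) (u : U) (v : V) (o : O) : ℝ :=
  ∑ s', Z s' u o * ∑ s, T s u v s' * P s v * b s

/-- Unnormalized belief update
`F_P(b,u,v,o)(s') = Z(s',u,o) Σ_s T(s,u,v,s') P(s,v) b(s)`. -/
def unnormUpd [Fintype S] (T : S → U → V → S → ℝ) (Z : S → U → O → ℝ)
    (P : S → V → ℝ) (b : S → ℝ) (u : U) (v : V) (o : O) (s' : S) : ℝ :=
  Z s' u o * ∑ s, T s u v s' * P s v * b s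

/-- Normalized belief update `B_P(b,u,v,o)`. -/
def beliefUpd [Fintype S] (T : S → U → V → S → ℝ) (Z : S → U → O → ℝ)
    (P : S → V → ℝ) (b : S → ℝ) (u : U) (v : V) (o : O) (s' : S) : ℝ :=
  unnormUpd T Z P b u v o s' / obsPr T Z P b u v o

/-- Value function of I-POMDP Lite: `V^P_0(b) = 0` and
`V^P_{n+1}(b) = max_u [ R_P(b,u) + φ Σ_{v,o} Pr_P(v,o|b,u) V^P_n(B_P(b,u,v,o)) ]`
(summands with `Pr_P(v,o|b,u) = 0` vanish since they are multiplied by `0`). -/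
def valFun [Fintype S] [Fintype U] [Fintype V] [Fintype O] [Nonempty U]
    (T : S → U → V → S → ℝ) (Z : S → U → O → ℝ) (R : S → U → V → ℝ)
    (P : S → V → ℝ) (φ : ℝ) : ℕ → (S → ℝ) → ℝ
  | 0, _ => 0
  | n + 1, b => ⨆ u : U, (expR R P b u +
      φ * ∑ v, ∑ o, obsPr T Z P b u v o * valFun T Z R P φ n (beliefUpd T Z P b u v o))

/-- Q-function of I-POMDP Lite: `qFun … n` is `Q^P_{n+1}`, i.e.
`Q^P_{n+1}(b,u) = R_P(b,u) + φ Σ_{v,o} Pr_P(v,o|b,u) V^P_n(B_P(b,u,v,o))`,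
so that `V^P_{n+1}(b) = max_u (qFun … n b u)`. -/
def qFun [Fintype S] [Fintype U] [Fintype V] [Fintype O] [Nonempty U]
    (T : S → U → V → S → ℝ) (Z : S → U → O → ℝ) (R : S → U → V → ℝ)
    (P : S → V → ℝ) (φ : ℝ) (n : ℕ) (b : S → ℝ) (u : U) : ℝ :=
  expR R P b u +
    φ * ∑ v, ∑ o, obsPr T Z P b u v o * valFun T Z R P φ n (beliefUpd T Z P b u v o)

/-- Prediction error `ε_p = max_{s,v} |Pr*(s,v) − Pr(s,v)|`. -/
def predErr [Fintype S] [Fintype V] [Nonempty S] [Nonempty V]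
    (Pstar Ppred : S → V → ℝ) : ℝ :=
  ⨆ s : S, ⨆ v : V, |Pstar s v - Ppred s v|

/-- Expected total reward of executing the (greedy) policy `π` under the true
strategy `Pstar`: `J_0(b) = 0` and
`J_{k+1}(b) = R_{P*}(b,π_{k+1}(b)) + φ Σ_{v,o} Pr_{P*}(v,o|b,π_{k+1}(b)) J_k(B_{P*}(b,π_{k+1}(b),v,o))`. -/
def execJ [Fintype S] [Fintype V] [Fintype O]
    (T : S → U → V → S → ℝ) (Z : S → U → O → ℝ) (R : S → U → V → ℝ)
    (Pstar : S → V → ℝ) (φ : ℝ) (π : ℕ → (S → ℝ) → U) : ℕ → (S → ℝ) → ℝ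
  | 0, _ => 0
  | k + 1, b =>
      expR R Pstar b (π (k + 1) b) +
        φ * ∑ v, ∑ o, obsPr T Z Pstar b (π (k + 1) b) v o *
          execJ T Z R Pstar φ π k (beliefUpd T Z Pstar b (π (k + 1) b) v o)

theorem unnormUpd_nonneg [Fintype S] {T : S → U → V → S → ℝ} {Z : S → U → O → ℝ}
    {P : S → V → ℝ} {b : S → ℝ} (hT : ∀ s u v s', 0 ≤ T s u v s') (hZ : ∀ s' u o, 0 ≤ Z s' u o)
    (hP : ∀ s v, 0 ≤ P s v) (hb : ∀ s, 0 ≤ b s) (u : U) (v : V) (o : O) (s' : S) :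
    0 ≤ unnormUpd T Z P b u v o s' :=
  mul_nonneg (hZ _ _ _) (sum_nonneg fun s _ =>
    mul_nonneg (mul_nonneg (hT _ _ _ _) (hP _ _)) (hb s))

/-- Positive homogeneity: scaling the value at a normalized vector recovers the maximum of the
linear functionals at the unnormalized one. -/
theorem sum_mul_eq_sup' [Fintype S] {W : (S → ℝ) → ℝ} {Γ : Finset (S → ℝ)} (hΓ : Γ.Nonempty)
    (hW : ∀ b : S → ℝ, IsBelief b → W b = Γ.sup' hΓ (fun α => ∑ s, α s * b s))
    {F : S → ℝ} (hF : ∀ s, 0 ≤ F s) :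
    (∑ s, F s) * W (fun s => F s / ∑ t, F t) = Γ.sup' hΓ (fun α => ∑ s, α s * F s) := by
  have hp : 0 ≤ ∑ s, F s := sum_nonneg fun s _ => hF s
  rcases hp.eq_or_lt with h0 | hpos
  · have hF0 : ∀ s, F s = 0 := fun s =>
      (sum_eq_zero_iff_of_nonneg fun t _ => hF t).1 h0.symm s (mem_univ s)
    simp [hF0]
  · have hbel : IsBelief (fun s => F s / ∑ t, F t) :=
      ⟨fun s => div_nonneg (hF s) hp, by rw [← sum_div, div_self hpos.ne']⟩
    rw [hW _ hbel, mul₀_sup' hp]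
    refine sup'_congr hΓ rfl fun α _ => ?_
    rw [mul_sum]
    refine sum_congr rfl fun s _ => ?_
    field_simp

/-- The `α` vector of the plan that plays `u` and then follows `f (v, o)` after observing
`(v, o)`. -/
def backupVec [Fintype S] [Fintype V] [Fintype O]
    (T : S → U → V → S → ℝ) (Z : S → U → O → ℝ) (R : S → U → V → ℝ)
    (P : S → V → ℝ) (φ : ℝ) (u : U) (f : V × O → S → ℝ) (s : S) : ℝ :=
  ∑ v, P s v * R s u v +
    φ * ∑ v, ∑ o, ∑ s', f (v, o) s' * (Z s' u o * (T s u v s' * P s v))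

theorem sum_backupVec_mul [Fintype S] [Fintype V] [Fintype O]
    (T : S → U → V → S → ℝ) (Z : S → U → O → ℝ) (R : S → U → V → ℝ)
    (P : S → V → ℝ) (φ : ℝ) (u : U) (f : V × O → S → ℝ) (b : S → ℝ) :
    ∑ s, backupVec T Z R P φ u f s * b s =
      expR R P b u + φ * ∑ v, ∑ o, ∑ s', f (v, o) s' * unnormUpd T Z P b u v o s' := by
  simp only [backupVec, expR, unnormUpd, add_mul, sum_add_distrib]
  congr 1
  · refine sum_congr rfl fun s _ => ?_
    rw [sum_mul]
    exact sum_congr rfl fun v _ => by ring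
  · simp only [mul_sum, sum_mul]
    rw [sum_comm]
    refine sum_congr rfl fun v _ => ?_
    rw [sum_comm]
    refine sum_congr rfl fun o _ => ?_
    rw [sum_comm]
    exact sum_congr rfl fun s' _ => sum_congr rfl fun s _ => by ring

/-- **Backup preserves piecewise linearity and convexity:** if `V_n` is represented
by a nonempty finite set `Γ` of `α` vectors then `V_{n+1}` is represented by a
nonempty finite set `Γ'` of `α` vectors with `|Γ'| ≤ |U| · |Γ|^(|V|·|O|)`. -/
theorem ipomdp_lite_backup_alpha_vectors
    [Fintype S] [Fintype U] [Fintype V] [Fintype O]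
    [Nonempty S] [Nonempty U] [Nonempty V] [Nonempty O]
    (T : S → U → V → S → ℝ) (Z : S → U → O → ℝ) (R : S → U → V → ℝ)
    (Pr : S → V → ℝ) (φ : ℝ)
    (hT0 : ∀ s u v s', 0 ≤ T s u v s') (hT1 : ∀ s u v, ∑ s', T s u v s' = 1)
    (hZ0 : ∀ s' u o, 0 ≤ Z s' u o) (hZ1 : ∀ s' u, ∑ o, Z s' u o = 1)
    (hφ0 : 0 < φ) (hφ1 : φ < 1)
    (hPr : IsStrategy Pr)
    (n : ℕ) (Γ : Finset (S → ℝ)) (hΓ : Γ.Nonempty)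
    (hrep : ∀ b : S → ℝ, IsBelief b →
      valFun T Z R Pr φ n b = Γ.sup' hΓ (fun α => ∑ s, α s * b s)) :
    ∃ (Γ' : Finset (S → ℝ)) (hΓ' : Γ'.Nonempty),
      (∀ b : S → ℝ, IsBelief b →
        valFun T Z R Pr φ (n + 1) b = Γ'.sup' hΓ' (fun α => ∑ s, α s * b s)) ∧
      Γ'.card ≤ Fintype.card U * Γ.card ^ (Fintype.card V * Fintype.card O) := by
  classical
  let plans : Finset (U × (V × O → S → ℝ)) := univ ×ˢ Fintype.piFinset fun _ => Γ
  have hplans : plans.Nonempty :=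
    univ_nonempty.product (Fintype.piFinset_nonempty.2 fun _ => hΓ)
  refine ⟨plans.image fun p => backupVec T Z R Pr φ p.1 p.2, hplans.image _, fun b hb => ?_, ?_⟩
  · have hterm : ∀ u v o, obsPr T Z Pr b u v o * valFun T Z R Pr φ n (beliefUpd T Z Pr b u v o) =
        Γ.sup' hΓ (fun α => ∑ s, α s * unnormUpd T Z Pr b u v o s) := fun u v o =>
      sum_mul_eq_sup' hΓ hrep (unnormUpd_nonneg hT0 hZ0 hPr.1 hb.1 u v o)
    rw [sup'_image]
    simp only [valFun, hterm]
    apply le_antisymm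
    · refine ciSup_le fun u => ?_
      choose f hf hfeq using fun x : V × O =>
        Γ.exists_mem_eq_sup' hΓ (fun α => ∑ s, α s * unnormUpd T Z Pr b u x.1 x.2 s)
      have hmem : (u, f) ∈ plans :=
        mem_product.2 ⟨mem_univ _, Fintype.mem_piFinset.2 hf⟩
      refine le_sup'_of_le _ hmem (le_of_eq ?_)
      simp only [Function.comp_apply, sum_backupVec_mul]
      simp only [fun v o => hfeq (v, o)]
    · refine sup'_le _ _ fun p hp => ?_
      have hp2 := Fintype.mem_piFinset.1 (mem_product.1 hp).2
      simp only [Function.comp_apply, sum_backupVec_mul]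
      refine le_ciSup_of_le (Set.finite_range _).bddAbove p.1 ?_
      gcongr with v _ o _
      exact le_sup' (fun α : S → ℝ => ∑ s, α s * unnormUpd T Z Pr b p.1 v o s) (hp2 (v, o))
  · refine card_image_le.trans (le_of_eq ?_)
    simp [plans, card_product, Fintype.card_piFinset]
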